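/- Let λ>0, 0<q<1, p=1, 0≤c₁<c₂≤∞, and let v be a non-negative measurable weight on (0,∞). Denote v̄(t)=ess sup_{c₁<x<t} v(x). With the convention c₂^{−λ}:=0 when c₂=∞, define B=(∫_{c₁}^{c₂} (t^{−λ}−c₂^{−λ})^{q/(1−q)} t^{−λ−1} v̄(t)^{q/(1−q)} dt)^{(1−q)/q} and D=c₂^{−λ/q} v̄(c₂). Let C be the least constant (possibly ∞) such that (∫_0^∞ (∫_{c₁}^{c₂} e^{−x y^λ} f(y) v(y) dy)^q dx)^{1/q} ≤ C ∫_{c₁}^{c₂} f holds for all measurable f≥0. Then α₄ · ess sup_{c₁<t<c₂} t^{−λ/q} v(t) ≤ C ≤ β₄ B + q^{−2/q} D, where α₄=q^{−1/q} and β₄=λ^{(1−q)/q} q^{−2/q} (1−q)^{−(1−q)/q}. -/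

import Mathlib

open MeasureTheory Set Filter Topology
open scoped ENNReal NNReal

noncomputable section

/-- The interval `(c₁, c₂)` on the half-line, where the upper endpoint `c₂` may be infinite. -/
def Ival (c₁ : ℝ) (c₂ : ℝ≥0∞) : Set ℝ := {y : ℝ | c₁ < y ∧ ENNReal.ofReal y < c₂}

/-- `v̄(t) = ess sup_{c₁ < x < t} v(x)`. -/
def vbar (c₁ : ℝ) (v : ℝ → ℝ) (t : ℝ) : ℝ≥0∞ :=
  essSup (fun x => ENNReal.ofReal (v x)) (volume.restrict (Ioo c₁ t))

/-- `v̄(c₂) = ess sup_{c₁ < x < c₂} v(x)`. -/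
def vbarAll (c₁ : ℝ) (c₂ : ℝ≥0∞) (v : ℝ → ℝ) : ℝ≥0∞ :=
  essSup (fun x => ENNReal.ofReal (v x)) (volume.restrict (Ival c₁ c₂))

/-- The least constant `C` (possibly `∞`) such that
`(∫_0^∞ (∫_{c₁}^{c₂} e^{-x y^λ} f v)^q dx)^{1/q} ≤ C ∫_{c₁}^{c₂} f`
holds for all measurable `f ≥ 0`. -/
def CLap1 (lam q c₁ : ℝ) (c₂ : ℝ≥0∞) (v : ℝ → ℝ) : ℝ≥0∞ :=
  sInf {c : ℝ≥0∞ | ∀ f : ℝ → ℝ, Measurable f → (∀ y, 0 ≤ f y) →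
    (∫⁻ x in Ioi (0:ℝ), (∫⁻ y in Ival c₁ c₂,
        ENNReal.ofReal (Real.exp (-(x * y ^ lam))) * ENNReal.ofReal (f y)
          * ENNReal.ofReal (v y)) ^ q) ^ (1/q)
      ≤ c * ∫⁻ y in Ival c₁ c₂, ENNReal.ofReal (f y)}


/-! ### Powers of the distribution function of an atomless measure -/

lemma continuous_measure_Iic (μ : Measure ℝ) [IsFiniteMeasure μ] [NullSingletonClass μ] :
    Continuous fun y => μ (Iic y) := by
  refine continuous_iff_continuousAt.2 fun y => ?_
  refine tendsto_measure_of_ae_tendsto_indicator_of_isFiniteMeasure _ measurableSet_Iic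
    (fun _ => measurableSet_Iic) ?_
  filter_upwards [(countable_singleton y).ae_notMem μ] with x hx
  rcases lt_or_gt_of_ne (show x ≠ y from hx) with h | h
  · filter_upwards [Ioi_mem_nhds h] with z hz
    exact ⟨fun _ => h.le, fun _ => (show x < z from hz).le⟩
  · filter_upwards [Iio_mem_nhds h] with z hz
    exact ⟨fun h' => absurd (show x ≤ z from h') (not_le.2 hz),
      fun h' => absurd (show x ≤ y from h') (not_le.2 h)⟩

lemma tendsto_measure_Iic_atBot_zero (μ : Measure ℝ) [IsFiniteMeasure μ] :
    Tendsto (fun y => μ (Iic y)) atBot (𝓝 0) := by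
  rw [← measure_empty (μ := μ)]
  refine tendsto_measure_of_ae_tendsto_indicator_of_isFiniteMeasure _ MeasurableSet.empty
    (fun _ => measurableSet_Iic) (ae_of_all _ fun x => ?_)
  filter_upwards [Iio_mem_atBot x] with z hz
  simpa using hz

/-- The distribution function of an atomless measure is uniformly distributed. -/
lemma measure_setOf_measure_Iic_le (μ : Measure ℝ) [IsFiniteMeasure μ] [NullSingletonClass μ]
    (u : ℝ≥0∞) : μ {y | μ (Iic y) ≤ u} = min u (μ univ) := by
  have hcont := continuous_measure_Iic μ
  rcases le_or_gt (μ univ) u with hu | hu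
  · rw [min_eq_right hu]
    congr 1
    exact eq_univ_of_forall fun y => (measure_mono (subset_univ _)).trans hu
  rw [min_eq_left hu.le]
  have hmono : Monotone fun y => μ (Iic y) := fun a b h => measure_mono (Iic_subset_Iic.2 h)
  apply le_antisymm
  · rcases eq_empty_or_nonempty {y | μ (Iic y) ≤ u} with h | h
    · simp [h]
    have hbdd : BddAbove {y | μ (Iic y) ≤ u} := by
      obtain ⟨z, hz⟩ := ((tendsto_measure_Iic_atTop μ).eventually (lt_mem_nhds hu)).exists
      refine ⟨z, fun y hy => ?_⟩
      by_contra hcon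
      exact absurd (hz.trans_le (hmono (not_le.1 hcon).le)) (not_lt.2 hy)
    have hclosed : IsClosed {y | μ (Iic y) ≤ u} := isClosed_le hcont continuous_const
    exact (measure_mono fun y hy => le_csSup hbdd hy).trans (hclosed.csSup_mem h hbdd)
  · rcases eq_or_ne u 0 with rfl | h0
    · exact zero_le
    obtain ⟨a, ha⟩ := ((tendsto_measure_Iic_atBot_zero μ).eventually
      (gt_mem_nhds h0.bot_lt)).exists
    obtain ⟨b, hb⟩ := ((tendsto_measure_Iic_atTop μ).eventually (lt_mem_nhds hu)).exists
    obtain ⟨c, hc⟩ := mem_range_of_exists_le_of_exists_ge hcont ⟨a, ha.le⟩ ⟨b, hb.le⟩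
    rw [← hc]
    exact measure_mono fun y hy => hmono hy

lemma map_measureReal_Iic (μ : Measure ℝ) [IsFiniteMeasure μ] [NullSingletonClass μ] :
    μ.map (fun y => μ.real (Iic y)) = volume.restrict (Ioc 0 (μ.real univ)) := by
  have hmeas : Measurable fun y => μ.real (Iic y) :=
    (Monotone.measurable fun a b h => measure_mono (Iic_subset_Iic.2 h)).ennreal_toReal
  refine Measure.ext_of_Iic _ _ fun u => ?_
  rw [Measure.map_apply hmeas measurableSet_Iic, Measure.restrict_apply measurableSet_Iic]
  rcases lt_or_ge u 0 with hu | hu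
  · have h1 : (fun y => μ.real (Iic y)) ⁻¹' Iic u = ∅ := by
      ext y
      simpa using hu.trans_le measureReal_nonneg
    have h2 : Iic u ∩ Ioc 0 (μ.real univ) = ∅ := by
      ext y
      simp only [mem_inter_iff, mem_Iic, mem_Ioc, mem_empty_iff_false, iff_false]
      intro h
      linarith [h.1, h.2.1]
    rw [h1, h2]
    simp
  · have h1 : (fun y => μ.real (Iic y)) ⁻¹' Iic u = {y | μ (Iic y) ≤ ENNReal.ofReal u} := by
      ext y
      simp only [mem_preimage, mem_Iic, mem_ofPred_eq, measureReal_def]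
      rw [ENNReal.le_ofReal_iff_toReal_le (measure_ne_top _ _) hu]
    have h2 : Iic u ∩ Ioc 0 (μ.real univ) = Ioc 0 (min u (μ.real univ)) := by
      ext y
      simp only [mem_inter_iff, mem_Iic, mem_Ioc, le_min_iff]
      tauto
    rw [h1, h2, measure_setOf_measure_Iic_le, Real.volume_Ioc, sub_zero,
      ENNReal.ofReal_min, ofReal_measureReal]

lemma lintegral_rpow_Ioc {a m : ℝ} (ha : 0 < a) (hm : 0 ≤ m) :
    ∫⁻ u in Ioc 0 m, ENNReal.ofReal u ^ (a - 1) = ENNReal.ofReal m ^ a / ENNReal.ofReal a := by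
  have h1 : ∫⁻ u in Ioc 0 m, ENNReal.ofReal u ^ (a - 1)
      = ∫⁻ u in Ioc 0 m, ENNReal.ofReal (u ^ (a - 1)) :=
    setLIntegral_congr_fun measurableSet_Ioc fun u hu => ENNReal.ofReal_rpow_of_pos hu.1
  have h2 : IntegrableOn (fun u : ℝ => u ^ (a - 1)) (Ioc 0 m) :=
    (intervalIntegrable_iff_integrableOn_Ioc_of_le hm).1
      (intervalIntegral.intervalIntegrable_rpow' (by linarith))
  rw [h1, ← ofReal_integral_eq_lintegral_ofReal h2
    ((ae_restrict_mem measurableSet_Ioc).mono fun u hu => Real.rpow_nonneg hu.1.le _),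
    ← intervalIntegral.integral_of_le hm, integral_rpow (Or.inl (by linarith)),
    sub_add_cancel, Real.zero_rpow ha.ne', sub_zero, ENNReal.ofReal_div_of_pos ha,
    ENNReal.ofReal_rpow_of_nonneg hm ha.le]

lemma lintegral_rpow_measure_Iic_of_finite (μ : Measure ℝ) [IsFiniteMeasure μ]
    [NullSingletonClass μ] {a : ℝ} (ha : 0 < a) :
    ∫⁻ y, μ (Iic y) ^ (a - 1) ∂μ = μ univ ^ a / ENNReal.ofReal a := by
  have hmeas : Measurable fun y => μ.real (Iic y) :=
    (Monotone.measurable fun a b h => measure_mono (Iic_subset_Iic.2 h)).ennreal_toReal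
  have h := lintegral_map (μ := μ) (f := fun u => ENNReal.ofReal u ^ (a - 1))
    (g := fun y => μ.real (Iic y)) (by fun_prop) hmeas
  rw [map_measureReal_Iic, lintegral_rpow_Ioc ha measureReal_nonneg] at h
  simpa [ofReal_measureReal] using h.symm

lemma iUnion_Iic_natCast : ⋃ n : ℕ, Iic (n : ℝ) = univ :=
  eq_univ_of_forall fun y => mem_iUnion.2 (exists_nat_ge y)

lemma monotone_Iic_natCast : Monotone fun n : ℕ => Iic (n : ℝ) :=
  fun _ _ h => Iic_subset_Iic.2 (Nat.cast_le.2 h)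

lemma lintegral_eq_iSup_setLIntegral_Iic (μ : Measure ℝ) (g : ℝ → ℝ≥0∞) :
    ∫⁻ y, g y ∂μ = ⨆ n : ℕ, ∫⁻ y in Iic (n : ℝ), g y ∂μ := by
  rw [← setLIntegral_iUnion_of_directed g monotone_Iic_natCast.directed_le, iUnion_Iic_natCast,
    setLIntegral_univ]

/-- Fundamental theorem of calculus for powers of an atomless distribution function, on a
half-line. -/
lemma setLIntegral_rpow_measure_Iic (μ : Measure ℝ) [NullSingletonClass μ]
    (hfin : ∀ y, μ (Iic y) ≠ ∞) {a : ℝ} (ha : 0 < a) (z : ℝ) :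
    ∫⁻ y in Iic z, μ (Iic y) ^ (a - 1) ∂μ = μ (Iic z) ^ a / ENNReal.ofReal a := by
  have : IsFiniteMeasure (μ.restrict (Iic z)) := ⟨by simpa using (hfin z).lt_top⟩
  have h := lintegral_rpow_measure_Iic_of_finite (μ.restrict (Iic z)) ha
  rw [Measure.restrict_apply_univ] at h
  rw [← h]
  refine setLIntegral_congr_fun measurableSet_Iic fun y hy => ?_
  simp only [Measure.restrict_apply measurableSet_Iic,
    inter_eq_left.2 (Iic_subset_Iic.2 (show y ≤ z from hy))]

lemma lintegral_rpow_measure_Iic (μ : Measure ℝ) [NullSingletonClass μ]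
    (hfin : ∀ y, μ (Iic y) ≠ ∞) {a : ℝ} (ha : 0 < a) :
    ∫⁻ y, μ (Iic y) ^ (a - 1) ∂μ = μ univ ^ a / ENNReal.ofReal a := by
  rw [lintegral_eq_iSup_setLIntegral_Iic]
  simp only [setLIntegral_rpow_measure_Iic μ hfin ha]
  refine iSup_eq_of_tendsto (fun m n h => ?_) ?_
  · gcongr
  · refine ENNReal.Tendsto.div_const ?_ (Or.inr (by simpa using ha))
    exact ((ENNReal.continuous_rpow_const).tendsto _).comp
      ((tendsto_measure_Iic_atTop μ).comp tendsto_natCast_atTop_atTop)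

/-- The same identity for the tails of an atomless measure. -/
lemma lintegral_rpow_measure_Ici (μ : Measure ℝ) [IsFiniteMeasure μ] [NullSingletonClass μ]
    {a : ℝ} (ha : 0 < a) :
    ∫⁻ y, μ (Ici y) ^ (a - 1) ∂μ = μ univ ^ a / ENNReal.ofReal a := by
  have hm : MeasurableEmbedding (Neg.neg : ℝ → ℝ) := (MeasurableEquiv.neg ℝ).measurableEmbedding
  have : NullSingletonClass (μ.map Neg.neg) := ⟨fun x => by
    rw [hm.map_apply]
    simp⟩
  have h := lintegral_rpow_measure_Iic_of_finite (μ.map Neg.neg) ha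
  rw [hm.lintegral_map, hm.map_apply] at h
  simpa [hm.map_apply] using h

/-- Tonelli's theorem on the triangle `y ≤ s`. -/
lemma lintegral_setLIntegral_Iic_swap (μ ρ : Measure ℝ) [SFinite μ] [SFinite ρ]
    {a b : ℝ → ℝ≥0∞} (ha : Measurable a) (hb : Measurable b) :
    ∫⁻ s, a s * ∫⁻ y in Iic s, b y ∂μ ∂ρ = ∫⁻ y, b y * ∫⁻ s in Ici y, a s ∂ρ ∂μ := by
  have hS : MeasurableSet {z : ℝ × ℝ | z.2 ≤ z.1} := measurableSet_le measurable_snd measurable_fst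
  have hf : Measurable
      (Function.uncurry fun s y => {z : ℝ × ℝ | z.2 ≤ z.1}.indicator (fun z => a z.1 * b z.2) (s, y)) :=
    ((ha.comp measurable_fst).mul (hb.comp measurable_snd)).indicator hS
  have h := lintegral_lintegral_swap (μ := ρ) (ν := μ) hf.aemeasurable
  have h1 : ∀ s, ∫⁻ y, {z : ℝ × ℝ | z.2 ≤ z.1}.indicator (fun z => a z.1 * b z.2) (s, y) ∂μ
      = a s * ∫⁻ y in Iic s, b y ∂μ := by
    intro s
    rw [← lintegral_const_mul _ hb, ← lintegral_indicator measurableSet_Iic]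
    rfl
  have h2 : ∀ y, ∫⁻ s, {z : ℝ × ℝ | z.2 ≤ z.1}.indicator (fun z => a z.1 * b z.2) (s, y) ∂ρ
      = b y * ∫⁻ s in Ici y, a s ∂ρ := by
    intro y
    rw [← lintegral_const_mul _ ha, ← lintegral_indicator measurableSet_Ici]
    refine lintegral_congr fun s => ?_
    simp only [indicator, mem_ofPred_eq, mem_Ici, mul_comm]
  simpa only [h1, h2] using h

lemma measurable_measure_Iic (μ : Measure ℝ) : Measurable fun y => μ (Iic y) :=
  Monotone.measurable fun _ _ h => measure_mono (Iic_subset_Iic.2 h)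

lemma measurable_measure_Ici (μ : Measure ℝ) : Measurable fun y => μ (Ici y) :=
  Antitone.measurable fun _ _ h => measure_mono (Ici_subset_Ici.2 h)

/-! ### Reduction to a Hardy operator -/

lemma rpow_lintegral_le_of_antitoneOn (μ : Measure ℝ) [SFinite μ] [NullSingletonClass μ]
    (hfin : ∀ y, μ (Iic y) ≠ ∞) {S : Set ℝ} (hS : ∀ᵐ y ∂μ, y ∈ S) {φ : ℝ → ℝ≥0∞}
    (hφ : Measurable φ) (hanti : AntitoneOn φ S) (hφ0 : ∀ y ∈ S, φ y ≠ 0)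
    (hφ1 : ∀ y ∈ S, φ y ≤ 1) {q : ℝ} (hq : 0 < q) (hq1 : q ≤ 1) :
    (∫⁻ y, φ y ∂μ) ^ q ≤ ENNReal.ofReal q * ∫⁻ y, μ (Iic y) ^ (q - 1) * φ y ^ q ∂μ := by
  have hν : ∀ y, μ.withDensity φ (Iic y) = ∫⁻ z in Iic y, φ z ∂μ := fun y =>
    withDensity_apply _ measurableSet_Iic
  have hνfin : ∀ y, μ.withDensity φ (Iic y) ≠ ∞ := by
    intro y
    rw [hν]
    refine ne_top_of_le_ne_top (hfin y) ?_
    rw [← setLIntegral_one]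
    exact lintegral_mono_ae (ae_restrict_of_ae (hS.mono hφ1))
  have h := lintegral_rpow_measure_Iic (μ.withDensity φ) hνfin hq
  rw [withDensity_apply _ MeasurableSet.univ, setLIntegral_univ,
    lintegral_withDensity_eq_lintegral_mul _ hφ
      ((measurable_measure_Iic _).pow_const _)] at h
  have hq0 : ENNReal.ofReal q ≠ 0 := by simpa using hq
  calc (∫⁻ y, φ y ∂μ) ^ q
      = ENNReal.ofReal q * ((∫⁻ y, φ y ∂μ) ^ q / ENNReal.ofReal q) :=
        (ENNReal.mul_div_cancel hq0 ENNReal.ofReal_ne_top).symm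
    _ ≤ _ := by
      rw [← h]
      gcongr ENNReal.ofReal q * ?_
      refine lintegral_mono_ae (hS.mono fun y hy => ?_)
      have hle : φ y * μ (Iic y) ≤ μ.withDensity φ (Iic y) := by
        rw [hν, ← setLIntegral_const]
        refine lintegral_mono_ae ?_
        filter_upwards [ae_restrict_of_ae hS, ae_restrict_mem measurableSet_Iic] with z hz hzy
        exact hanti hz hy hzy
      have hφt : φ y ≠ ∞ := ne_top_of_le_ne_top ENNReal.one_ne_top (hφ1 y hy)
      calc φ y * μ.withDensity φ (Iic y) ^ (q - 1)
          ≤ φ y * (φ y * μ (Iic y)) ^ (q - 1) := by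
            gcongr φ y * ?_
            rw [← neg_sub, ENNReal.rpow_neg, ENNReal.rpow_neg]
            exact ENNReal.inv_le_inv.2 (ENNReal.rpow_le_rpow hle (by linarith))
        _ = μ (Iic y) ^ (q - 1) * φ y ^ q := by
            rw [ENNReal.mul_rpow_of_ne_top hφt (hfin y), ← mul_assoc, mul_comm]
            congr 1
            conv_lhs => rw [← ENNReal.rpow_one (φ y), ← ENNReal.rpow_mul,
              ← ENNReal.rpow_add _ _ (hφ0 y hy) hφt]
            congr 1
            ring

lemma lintegral_rpow_mul_measure_Ici (μ ρ : Measure ℝ) [SFinite μ] [SFinite ρ]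
    [NullSingletonClass μ] (hfin : ∀ y, μ (Iic y) ≠ ∞) {q : ℝ} (hq : 0 < q) :
    ∫⁻ y, μ (Iic y) ^ (q - 1) * ρ (Ici y) ∂μ
      = (∫⁻ s, μ (Iic s) ^ q ∂ρ) / ENNReal.ofReal q := by
  have h := lintegral_setLIntegral_Iic_swap μ ρ (a := fun _ => 1) measurable_const
    ((measurable_measure_Iic μ).pow_const (q - 1))
  simp only [one_mul, setLIntegral_one, setLIntegral_rpow_measure_Iic μ hfin hq] at h
  rw [← h]
  simp only [div_eq_mul_inv]
  rw [lintegral_mul_const _ ((measurable_measure_Iic μ).pow_const _)]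

/-! ### A weighted Hardy inequality with `p = 1` and `0 < q < 1` -/

/-- A function dominating `s ↦ (ρ [t, ∞) * V t) ^ r` for all `t ≤ s`, with comparable integral. -/
def hardyMajorant (ρ : Measure ℝ) (V : ℝ → ℝ≥0∞) (r t : ℝ) : ℝ≥0∞ :=
  (ρ (Ici t) * V t) ^ r + ENNReal.ofReal r * ∫⁻ s in Iic t, ρ (Ici s) ^ (r - 1) * V s ^ r ∂ρ

lemma measurable_hardyMajorant (ρ : Measure ℝ) {V : ℝ → ℝ≥0∞} (hV : Monotone V) (r : ℝ) :
    Measurable (hardyMajorant ρ V r) := by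
  refine (((measurable_measure_Ici ρ).mul hV.measurable).pow_const r).add
    (Measurable.const_mul (Monotone.measurable fun a b h => ?_) _)
  exact lintegral_mono_set (Iic_subset_Iic.2 h)

lemma le_hardyMajorant (ρ : Measure ℝ) [NullSingletonClass ρ] {V : ℝ → ℝ≥0∞}
    (hV : Monotone V) {r : ℝ} (hr : 0 < r) {t s : ℝ} (hts : t ≤ s) (hfin : ρ (Ici t) ≠ ∞) :
    (ρ (Ici t) * V t) ^ r ≤ hardyMajorant ρ V r s := by
  have hr0 : ENNReal.ofReal r ≠ 0 := by simpa using hr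
  have key : ∀ u, ρ (Ici u) ≠ ∞ →
      ENNReal.ofReal r * ∫⁻ y in Ici u, ρ (Ici y) ^ (r - 1) ∂ρ = ρ (Ici u) ^ r := by
    intro u hu
    have : IsFiniteMeasure (ρ.restrict (Ici u)) := ⟨by simpa using hu.lt_top⟩
    have h := lintegral_rpow_measure_Ici (ρ.restrict (Ici u)) hr
    rw [Measure.restrict_apply_univ] at h
    rw [← ENNReal.mul_div_cancel (a := ENNReal.ofReal r) (b := ρ (Ici u) ^ r) hr0
      ENNReal.ofReal_ne_top, ← h]
    congr 1
    refine setLIntegral_congr_fun measurableSet_Ici fun y hy => ?_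
    simp only [Measure.restrict_apply measurableSet_Ici,
      inter_eq_left.2 (Ici_subset_Ici.2 (show u ≤ y from hy))]
  have hfin' : ρ (Ici s) ≠ ∞ := ne_top_of_le_ne_top hfin (measure_mono (Ici_subset_Ici.2 hts))
  have hsplit : ρ (Ici t) ^ r
      = ENNReal.ofReal r * ∫⁻ y in Ico t s, ρ (Ici y) ^ (r - 1) ∂ρ + ρ (Ici s) ^ r := by
    rw [← key t hfin, ← key s hfin', ← mul_add, ← Ico_union_Ici_eq_Ici hts,
      lintegral_union measurableSet_Ici]
    exact disjoint_left.2 fun y hy hy' => absurd hy.2 (not_lt.2 hy')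
  rw [ENNReal.mul_rpow_of_nonneg _ _ hr.le, hsplit, add_mul, add_comm, hardyMajorant,
    ENNReal.mul_rpow_of_nonneg _ _ hr.le]
  gcongr ρ (Ici s) ^ r * ?_ + ?_
  · exact ENNReal.rpow_le_rpow (hV hts) hr.le
  · rw [mul_assoc]
    gcongr ENNReal.ofReal r * ?_
    rw [← lintegral_mul_const _ ((measurable_measure_Ici ρ).pow_const _)]
    refine (setLIntegral_mono' measurableSet_Ico fun y hy => ?_).trans
      (lintegral_mono_set fun y hy => hy.2.le)
    gcongr
    exact hV hy.1

lemma lintegral_hardyMajorant (ρ : Measure ℝ) [SFinite ρ] {S : Set ℝ} (hS : ∀ᵐ t ∂ρ, t ∈ S)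
    (h0 : ∀ t ∈ S, ρ (Ici t) ≠ 0) (htop : ∀ t ∈ S, ρ (Ici t) ≠ ∞) {V : ℝ → ℝ≥0∞}
    (hV : Monotone V) {r : ℝ} (hr : 0 < r) :
    ∫⁻ t, hardyMajorant ρ V r t ∂ρ
      = ENNReal.ofReal (1 + r) * ∫⁻ t, (ρ (Ici t) * V t) ^ r ∂ρ := by
  have hm : Measurable fun s => ρ (Ici s) ^ (r - 1) * V s ^ r :=
    ((measurable_measure_Ici ρ).pow_const _).mul (hV.measurable.pow_const _)
  have h := lintegral_setLIntegral_Iic_swap ρ ρ (a := fun _ => 1) measurable_const hm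
  simp only [one_mul, setLIntegral_one] at h
  have hm' : Measurable fun t => (ρ (Ici t) * V t) ^ r :=
    ((measurable_measure_Ici ρ).mul hV.measurable).pow_const r
  simp only [hardyMajorant]
  rw [lintegral_add_left hm',
    lintegral_const_mul _ (Monotone.measurable fun a b h => lintegral_mono_set (Iic_subset_Iic.2 h)),
    h, ENNReal.ofReal_add zero_le_one hr.le, ENNReal.ofReal_one, add_mul, one_mul]
  congr 2
  refine lintegral_congr_ae (hS.mono fun t ht => ?_)
  dsimp only
  rw [ENNReal.mul_rpow_of_nonneg _ _ hr.le, mul_right_comm]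
  congr 1
  conv_lhs => rw [← ENNReal.rpow_one (ρ (Ici t)), ← ENNReal.rpow_mul,
    ← ENNReal.rpow_add _ _ (h0 t ht) (htop t ht)]
  congr 1
  ring

lemma hardy_inequality (μ ρ : Measure ℝ) [SFinite μ] [SFinite ρ] [NullSingletonClass ρ]
    {S : Set ℝ} (hμS : ∀ᵐ t ∂μ, t ∈ S) (hρS : ∀ᵐ t ∂ρ, t ∈ S)
    (h0 : ∀ t ∈ S, ρ (Ici t) ≠ 0) (htop : ∀ t ∈ S, ρ (Ici t) ≠ ∞) {V : ℝ → ℝ≥0∞}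
    (hV : Monotone V) (hV0 : ∀ s ∈ S, V s = 0 → μ (Iic s) = 0) {q : ℝ} (hq : 0 < q)
    (hq1 : q < 1) (hfin : ∫⁻ t, (ρ (Ici t) * V t) ^ (q / (1 - q)) ∂ρ ≠ ∞) :
    ∫⁻ s, μ (Iic s) ^ q ∂ρ ≤ (∫⁻ y, (V y)⁻¹ ∂μ) ^ q
      * (ENNReal.ofReal (1 - q)⁻¹ * ∫⁻ t, (ρ (Ici t) * V t) ^ (q / (1 - q)) ∂ρ) ^ (1 - q) := by
  have hq1' : 0 < 1 - q := by linarith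
  set r := q / (1 - q) with hr_def
  have hr : 0 < r := div_pos hq hq1'
  set K := hardyMajorant ρ V r with hK_def
  have hKm : Measurable K := measurable_hardyMajorant ρ hV r
  have hKint : ∫⁻ t, K t ∂ρ
      = ENNReal.ofReal (1 - q)⁻¹ * ∫⁻ t, (ρ (Ici t) * V t) ^ r ∂ρ := by
    rw [hK_def, lintegral_hardyMajorant ρ hρS h0 htop hV hr]
    congr 2
    rw [hr_def]
    field_simp
    ring
  have hKfin : ∀ᵐ t ∂ρ, K t < ∞ := by
    refine ae_lt_top hKm ?_
    rw [hKint]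
    exact ENNReal.mul_ne_top ENNReal.ofReal_ne_top hfin
  have hrq : r⁻¹ * q = 1 - q := by
    rw [hr_def]
    field_simp
  have hdual : ∫⁻ s, (K s)⁻¹ ^ r⁻¹ * μ (Iic s) ∂ρ ≤ ∫⁻ y, (V y)⁻¹ ∂μ := by
    have h := lintegral_setLIntegral_Iic_swap μ ρ (a := fun s => (K s)⁻¹ ^ r⁻¹)
      (b := fun _ => 1) (hKm.inv.pow_const _) measurable_const
    simp only [one_mul, setLIntegral_one] at h
    rw [h]
    refine lintegral_mono_ae (hμS.mono fun y hy => ?_)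
    calc ∫⁻ s in Ici y, (K s)⁻¹ ^ r⁻¹ ∂ρ
        ≤ ∫⁻ _ in Ici y, (ρ (Ici y) * V y)⁻¹ ∂ρ := by
          refine setLIntegral_mono' measurableSet_Ici fun s hs => ?_
          have hle := le_hardyMajorant ρ hV hr (show y ≤ s from hs) (htop y hy)
          calc (K s)⁻¹ ^ r⁻¹ ≤ ((ρ (Ici y) * V y) ^ r)⁻¹ ^ r⁻¹ := by
                exact ENNReal.rpow_le_rpow (ENNReal.inv_le_inv.2 hle) (inv_pos.2 hr).le
            _ = (ρ (Ici y) * V y)⁻¹ := by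
                rw [← ENNReal.inv_rpow, ENNReal.rpow_rpow_inv hr.ne']
      _ = (V y)⁻¹ := by
          rw [setLIntegral_const, ENNReal.mul_inv (Or.inl (h0 y hy)) (Or.inl (htop y hy)),
            mul_right_comm, ENNReal.inv_mul_cancel (h0 y hy) (htop y hy), one_mul]
  calc ∫⁻ s, μ (Iic s) ^ q ∂ρ
      ≤ ∫⁻ s, ((K s)⁻¹ ^ r⁻¹ * μ (Iic s)) ^ q * K s ^ (1 - q) ∂ρ := by
        refine lintegral_mono_ae ?_
        filter_upwards [hKfin, hρS] with s hs hsS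
        rcases eq_or_ne (K s) 0 with hK0 | hK0
        · have hle := le_hardyMajorant ρ hV hr le_rfl (htop s hsS)
          rw [← hK_def, hK0, nonpos_iff_eq_zero, ENNReal.rpow_eq_zero_iff_of_pos hr,
            mul_eq_zero] at hle
          rw [hV0 s hsS (hle.resolve_left (h0 s hsS)), ENNReal.zero_rpow_of_pos hq]
          exact zero_le
        · refine le_of_eq ?_
          rw [ENNReal.mul_rpow_of_nonneg _ _ hq.le, ← ENNReal.rpow_mul, hrq, mul_right_comm,
            ← ENNReal.mul_rpow_of_nonneg _ _ hq1'.le, ENNReal.inv_mul_cancel hK0 hs.ne,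
            ENNReal.one_rpow, one_mul]
    _ ≤ (∫⁻ s, (K s)⁻¹ ^ r⁻¹ * μ (Iic s) ∂ρ) ^ q * (∫⁻ s, K s ∂ρ) ^ (1 - q) :=
        ENNReal.lintegral_mul_norm_pow_le
          ((hKm.inv.pow_const _).mul (measurable_measure_Iic μ)).aemeasurable
          hKm.aemeasurable hq.le hq1'.le (by ring)
    _ ≤ _ := by
        rw [hKint]
        gcongr

/-! ### The power weight -/

lemma measurableSet_Ival (c₁ : ℝ) (c₂ : ℝ≥0∞) : MeasurableSet (Ival c₁ c₂) :=
  measurableSet_Ioi.inter (measurableSet_lt ENNReal.measurable_ofReal measurable_const)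

/-- The measure with density `λ t ^ (-λ - 1)` on the interval `(c₁, c₂)`. -/
def powMeasure (lam c₁ : ℝ) (c₂ : ℝ≥0∞) : Measure ℝ :=
  (volume.restrict (Ival c₁ c₂)).withDensity
    fun t => ENNReal.ofReal lam * ENNReal.ofReal t ^ (-lam - 1)

instance (lam c₁ : ℝ) (c₂ : ℝ≥0∞) : SFinite (powMeasure lam c₁ c₂) := by
  unfold powMeasure
  infer_instance

instance (lam c₁ : ℝ) (c₂ : ℝ≥0∞) : NullSingletonClass (powMeasure lam c₁ c₂) := by
  unfold powMeasure
  infer_instance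

lemma ae_mem_Ival_withDensity (c₁ : ℝ) (c₂ : ℝ≥0∞) (g : ℝ → ℝ≥0∞) :
    ∀ᵐ t ∂(volume.restrict (Ival c₁ c₂)).withDensity g, t ∈ Ival c₁ c₂ :=
  (withDensity_absolutelyContinuous _ g).ae_le (ae_restrict_mem (measurableSet_Ival c₁ c₂))

lemma powMeasure_Ici {lam c₁ : ℝ} {c₂ : ℝ≥0∞} (hlam : 0 < lam) (hc₁ : 0 ≤ c₁) {y : ℝ}
    (hy : y ∈ Ival c₁ c₂) :
    powMeasure lam c₁ c₂ (Ici y) = ENNReal.ofReal y ^ (-lam) - c₂ ^ (-lam) := by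
  have hy0 : 0 < y := hc₁.trans_lt hy.1
  rw [powMeasure, withDensity_apply _ measurableSet_Ici,
    Measure.restrict_restrict measurableSet_Ici]
  have hcongr : ∫⁻ t in Ici y ∩ Ival c₁ c₂, ENNReal.ofReal lam * ENNReal.ofReal t ^ (-lam - 1)
      = ∫⁻ t in Ici y ∩ Ival c₁ c₂, ENNReal.ofReal (lam * t ^ (-lam - 1)) := by
    refine setLIntegral_congr_fun (measurableSet_Ici.inter (measurableSet_Ival c₁ c₂))
      fun t ht => ?_
    rw [ENNReal.ofReal_rpow_of_pos (hy0.trans_le ht.1), ENNReal.ofReal_mul hlam.le]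
  rw [hcongr]
  have hpos : ∀ s : Set ℝ, MeasurableSet s → s ⊆ Ioi 0 →
      0 ≤ᵐ[volume.restrict s] fun t : ℝ => lam * t ^ (-lam - 1) := fun s hs hsub =>
    (ae_restrict_mem hs).mono fun t ht => mul_nonneg hlam.le (Real.rpow_nonneg (hsub ht).le _)
  rcases eq_or_ne c₂ ∞ with rfl | hc₂
  · have hset : Ici y ∩ Ival c₁ ∞ = Ici y :=
      inter_eq_left.2 fun t ht => ⟨hy.1.trans_le ht, ENNReal.ofReal_lt_top⟩
    rw [hset, setLIntegral_congr Ioi_ae_eq_Ici.symm, ← ofReal_integral_eq_lintegral_ofReal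
      ((integrableOn_Ioi_rpow_of_lt (by linarith) hy0).const_mul lam)
      (hpos _ measurableSet_Ioi (Ioi_subset_Ioi hy0.le)), integral_const_mul,
      integral_Ioi_rpow_of_lt (by linarith) hy0, ENNReal.top_rpow_of_neg (by linarith), tsub_zero,
      ENNReal.ofReal_rpow_of_pos hy0]
    congr 1
    rw [sub_add_cancel]
    field_simp
  · obtain ⟨b, hb0, rfl⟩ : ∃ b : ℝ, 0 ≤ b ∧ c₂ = ENNReal.ofReal b :=
      ⟨c₂.toReal, ENNReal.toReal_nonneg, (ENNReal.ofReal_toReal hc₂).symm⟩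
    have hyb : y < b := (ENNReal.ofReal_lt_ofReal_iff_of_nonneg hy0.le).1 hy.2
    have hset : Ici y ∩ Ival c₁ (ENNReal.ofReal b) = Ico y b := by
      ext t
      refine ⟨fun ht => ⟨ht.1, ?_⟩, fun ht => ⟨ht.1, hy.1.trans_le ht.1, ?_⟩⟩
      · exact (ENNReal.ofReal_lt_ofReal_iff_of_nonneg (hy0.le.trans ht.1)).1 ht.2.2
      · exact (ENNReal.ofReal_lt_ofReal_iff_of_nonneg (hy0.le.trans ht.1)).2 ht.2
    have h0 : (0 : ℝ) ∉ uIcc y b := by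
      rw [uIcc_of_le hyb.le]
      exact fun h => absurd h.1 (not_le.2 hy0)
    have hint : IntegrableOn (fun t : ℝ => t ^ (-lam - 1)) (Ioc y b) :=
      (intervalIntegrable_iff_integrableOn_Ioc_of_le hyb.le).1
        (intervalIntegral.intervalIntegrable_rpow (Or.inr h0))
    rw [hset, setLIntegral_congr Ico_ae_eq_Ioc, ← ofReal_integral_eq_lintegral_ofReal
      (hint.const_mul lam) (hpos _ measurableSet_Ioc fun t ht => hy0.trans ht.1),
      integral_const_mul, ← intervalIntegral.integral_of_le hyb.le,
      integral_rpow (Or.inr ⟨by linarith, h0⟩), ENNReal.ofReal_rpow_of_pos hy0,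
      ENNReal.ofReal_rpow_of_pos (hy0.trans hyb),
      ← ENNReal.ofReal_sub _ (Real.rpow_nonneg hb0 _)]
    congr 1
    rw [sub_add_cancel]
    field_simp
    ring

lemma rpow_neg_lt_rpow_neg {lam c₁ : ℝ} {c₂ : ℝ≥0∞} (hlam : 0 < lam) {y : ℝ}
    (hy : y ∈ Ival c₁ c₂) : c₂ ^ (-lam) < ENNReal.ofReal y ^ (-lam) := by
  rw [ENNReal.rpow_neg, ENNReal.rpow_neg]
  exact ENNReal.inv_lt_inv.2 (ENNReal.rpow_lt_rpow hy.2 hlam)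

lemma powMeasure_Ici_ne_zero {lam c₁ : ℝ} {c₂ : ℝ≥0∞} (hlam : 0 < lam) (hc₁ : 0 ≤ c₁) {y : ℝ}
    (hy : y ∈ Ival c₁ c₂) : powMeasure lam c₁ c₂ (Ici y) ≠ 0 := by
  rw [powMeasure_Ici hlam hc₁ hy]
  exact (tsub_pos_of_lt (rpow_neg_lt_rpow_neg hlam hy)).ne'

lemma powMeasure_Ici_ne_top {lam c₁ : ℝ} {c₂ : ℝ≥0∞} (hlam : 0 < lam) (hc₁ : 0 ≤ c₁) {y : ℝ}
    (hy : y ∈ Ival c₁ c₂) : powMeasure lam c₁ c₂ (Ici y) ≠ ∞ := by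
  rw [powMeasure_Ici hlam hc₁ hy]
  refine ne_top_of_le_ne_top ?_ tsub_le_self
  rw [ENNReal.ofReal_rpow_of_pos (hc₁.trans_lt hy.1)]
  exact ENNReal.ofReal_ne_top

lemma lintegral_powMeasure (lam c₁ : ℝ) (c₂ : ℝ≥0∞) {g : ℝ → ℝ≥0∞} (hg : Measurable g) :
    ∫⁻ t, g t ∂powMeasure lam c₁ c₂
      = ENNReal.ofReal lam * ∫⁻ t in Ival c₁ c₂, ENNReal.ofReal t ^ (-lam - 1) * g t := by
  rw [powMeasure, lintegral_withDensity_eq_lintegral_mul _ (by fun_prop) hg,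
    ← lintegral_const_mul _ (by fun_prop)]
  simp only [Pi.mul_apply, mul_assoc]

/-! ### The running essential supremum -/

lemma monotone_vbar (c₁ : ℝ) (v : ℝ → ℝ) : Monotone (vbar c₁ v) := fun _ _ h =>
  essSup_mono_measure (Measure.absolutelyContinuous_of_le
    (Measure.restrict_mono (Ioo_subset_Ioo_right h) le_rfl))

lemma ae_le_vbar (c₁ : ℝ) (v : ℝ → ℝ) :
    ∀ᵐ t, c₁ < t → ENNReal.ofReal (v t) ≤ vbar c₁ v t := by
  have h : ∀ᵐ t, ∀ b : ℚ, t ∈ Ioo c₁ (b : ℝ) → ENNReal.ofReal (v t) ≤ vbar c₁ v b :=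
    ae_all_iff.2 fun b => (ae_restrict_iff' measurableSet_Ioo).1 (ENNReal.ae_le_essSup _)
  filter_upwards [h, (monotone_vbar c₁ v).countable_not_continuousAt.ae_notMem volume]
    with t ht hcont hct
  have hcont : ContinuousAt (vbar c₁ v) t := not_not.1 hcont
  refine ge_of_tendsto (hcont.tendsto.mono_left (nhdsWithin_le_nhds (s := Ioi t))) ?_
  filter_upwards [self_mem_nhdsWithin] with s hs
  obtain ⟨b, hb1, hb2⟩ := exists_rat_btwn (show t < s from hs)
  exact (ht b ⟨hct, hb1⟩).trans (monotone_vbar c₁ v hb2.le)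

lemma setLIntegral_mul_le_essSup_mul {S T : Set ℝ} (hT : T ⊆ S) (f v : ℝ → ℝ≥0∞)
    (hf : Measurable f) :
    ∫⁻ y in T, f y * v y ≤ essSup v (volume.restrict T) * ∫⁻ y in S, f y := by
  calc ∫⁻ y in T, f y * v y ≤ ∫⁻ y in T, f y * essSup v (volume.restrict T) := by
        refine lintegral_mono_ae ((ENNReal.ae_le_essSup v).mono fun y hy => ?_)
        gcongr
    _ = essSup v (volume.restrict T) * ∫⁻ y in T, f y := by
        rw [lintegral_mul_const _ hf, mul_comm]
    _ ≤ _ := by gcongr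

/-! ### The Laplace operator is dominated by a Hardy operator -/

lemma lintegral_exp_rpow {k q : ℝ} (hk : 0 < k) (hq : 0 < q) :
    ∫⁻ x in Ioi (0 : ℝ), ENNReal.ofReal (Real.exp (-(x * k))) ^ q
      = ENNReal.ofReal (q * k)⁻¹ := by
  have h1 : ∀ x : ℝ, ENNReal.ofReal (Real.exp (-(x * k))) ^ q
      = ENNReal.ofReal (Real.exp (-(q * k) * x)) := by
    intro x
    rw [ENNReal.ofReal_rpow_of_pos (Real.exp_pos _), ← Real.exp_mul]
    congr 2
    ring
  have hneg : -(q * k) < 0 := neg_lt_zero.2 (mul_pos hq hk)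
  simp only [h1]
  rw [← ofReal_integral_eq_lintegral_ofReal (integrableOn_exp_mul_Ioi hneg 0)
    (ae_of_all _ fun x => (Real.exp_pos _).le), integral_exp_mul_Ioi hneg]
  congr 1
  simp

lemma lintegral_laplace_rpow_le {lam q c₁ : ℝ} {c₂ : ℝ≥0∞} (hlam : 0 < lam) (hq : 0 < q)
    (hq1 : q < 1) (hc₁ : 0 ≤ c₁) (μ : Measure ℝ) [SFinite μ] [NullSingletonClass μ]
    (hfin : ∀ y, μ (Iic y) ≠ ∞) (hμ : ∀ᵐ y ∂μ, y ∈ Ival c₁ c₂) :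
    ∫⁻ x in Ioi (0 : ℝ), (∫⁻ y, ENNReal.ofReal (Real.exp (-(x * y ^ lam))) ∂μ) ^ q
      ≤ (∫⁻ s, μ (Iic s) ^ q ∂powMeasure lam c₁ c₂ + c₂ ^ (-lam) * μ univ ^ q)
        / ENNReal.ofReal q := by
  have hpos : ∀ y ∈ Ival c₁ c₂, 0 < y := fun y hy => hc₁.trans_lt hy.1
  have hI : Measurable fun y => μ (Iic y) ^ (q - 1) := (measurable_measure_Iic μ).pow_const _
  calc ∫⁻ x in Ioi (0 : ℝ), (∫⁻ y, ENNReal.ofReal (Real.exp (-(x * y ^ lam))) ∂μ) ^ q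
      ≤ ∫⁻ x in Ioi (0 : ℝ), ENNReal.ofReal q * ∫⁻ y, μ (Iic y) ^ (q - 1)
          * ENNReal.ofReal (Real.exp (-(x * y ^ lam))) ^ q ∂μ := by
        refine setLIntegral_mono' measurableSet_Ioi fun x hx => ?_
        have hx : 0 < x := hx
        refine rpow_lintegral_le_of_antitoneOn μ hfin hμ (by fun_prop) ?_ ?_ ?_ hq hq1.le
        · intro a ha b hb hab
          have := (hpos a ha).le
          dsimp only
          gcongr
        · intro y hy
          simpa using Real.exp_pos _
        · intro y hy
          rw [ENNReal.ofReal_le_one, Real.exp_le_one_iff, neg_nonpos]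
          exact mul_nonneg hx.le (Real.rpow_nonneg (hpos y hy).le _)
    _ = ENNReal.ofReal q * ∫⁻ y, μ (Iic y) ^ (q - 1) * (∫⁻ x in Ioi (0 : ℝ),
          ENNReal.ofReal (Real.exp (-(x * y ^ lam))) ^ q) ∂μ := by
        have hm : Measurable (Function.uncurry fun x y : ℝ => μ (Iic y) ^ (q - 1)
            * ENNReal.ofReal (Real.exp (-(x * y ^ lam))) ^ q) :=
          (hI.comp measurable_snd).mul (by fun_prop)
        rw [lintegral_const_mul _ hm.lintegral_prod_right, lintegral_lintegral_swap hm.aemeasurable]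
        congr 1
        refine lintegral_congr fun y => ?_
        rw [lintegral_const_mul _ (by fun_prop)]
    _ = ∫⁻ y, μ (Iic y) ^ (q - 1) * powMeasure lam c₁ c₂ (Ici y)
          + c₂ ^ (-lam) * μ (Iic y) ^ (q - 1) ∂μ := by
        rw [← lintegral_const_mul' _ _ ENNReal.ofReal_ne_top]
        refine lintegral_congr_ae (hμ.mono fun y hy => ?_)
        have hy0 := hpos y hy
        dsimp only
        rw [lintegral_exp_rpow (Real.rpow_pos_of_pos hy0 _) hq, powMeasure_Ici hlam hc₁ hy,
          mul_comm (c₂ ^ (-lam)), ← mul_add,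
          tsub_add_cancel_of_le (rpow_neg_lt_rpow_neg hlam hy).le, mul_left_comm,
          ← ENNReal.ofReal_mul hq.le, ENNReal.ofReal_rpow_of_pos hy0, Real.rpow_neg hy0.le]
        congr 2
        field_simp
    _ = _ := by
        rw [lintegral_add_right _ (hI.const_mul _), lintegral_const_mul _ hI,
          lintegral_rpow_mul_measure_Ici μ _ hfin hq, lintegral_rpow_measure_Iic μ hfin hq,
          ENNReal.add_div, mul_div_assoc]

/-! ### Upper bound -/

lemma vbar_ne_top {lam r c₁ : ℝ} {c₂ : ℝ≥0∞} (hlam : 0 < lam) (hc₁ : 0 ≤ c₁) (hr : 0 < r)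
    (v : ℝ → ℝ)
    (hfin : ∫⁻ t, (powMeasure lam c₁ c₂ (Ici t) * vbar c₁ v t) ^ r ∂powMeasure lam c₁ c₂ ≠ ∞)
    {s : ℝ} (hs : s ∈ Ival c₁ c₂) : vbar c₁ v s ≠ ∞ := by
  have hm : Measurable fun t => (powMeasure lam c₁ c₂ (Ici t) * vbar c₁ v t) ^ r :=
    ((measurable_measure_Ici _).mul (monotone_vbar c₁ v).measurable).pow_const r
  obtain ⟨t, hst, ht, htS⟩ := Measure.exists_mem_of_measure_ne_zero_of_ae
    (powMeasure_Ici_ne_zero hlam hc₁ hs)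
    (ae_restrict_of_ae ((ae_lt_top hm hfin).and (ae_mem_Ival_withDensity c₁ c₂ _)))
  refine ne_top_of_le_ne_top (fun htop => ?_) (monotone_vbar c₁ v hst)
  rw [htop, ENNReal.mul_top (powMeasure_Ici_ne_zero hlam hc₁ htS), ENNReal.top_rpow_of_pos hr]
    at ht
  exact lt_irrefl _ ht

lemma mul_two_rpow_le_one {q : ℝ} (hq : 0 ≤ q) (hq1 : q ≤ 1) : q * 2 ^ (1 - q) ≤ 1 := by
  have h := _root_.rpow_one_add_le_one_add_mul_self (s := 1) (by norm_num)
    (p := 1 - q) (by linarith) (by linarith)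
  rw [one_add_one_eq_two] at h
  nlinarith [sq_nonneg (1 - q)]

lemma rpow_inv_le_of_le_add {q : ℝ} (hq : 0 < q) (hq1 : q < 1) {X F a d : ℝ≥0∞}
    (h : X ≤ (F ^ q * a ^ q + F ^ q * d ^ q) / ENNReal.ofReal q) :
    X ^ (1 / q) ≤ ENNReal.ofReal (q ^ (-2 / q)) * (a + d) * F := by
  have hq' : 0 < 1 / q := by positivity
  have hpow : ∀ z : ℝ≥0∞, (z ^ q) ^ (1 / q) = z := fun z => by
    rw [one_div, ENNReal.rpow_rpow_inv hq.ne']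
  have hconst : (2 : ℝ) ^ (1 / q - 1) * (q ^ (1 / q))⁻¹ ≤ q ^ (-2 / q) := by
    have h1 : (q * 2 ^ (1 - q)) ^ (1 / q) ≤ 1 :=
      Real.rpow_le_one (by positivity) (mul_two_rpow_le_one hq.le hq1.le) hq'.le
    rw [Real.mul_rpow hq.le (by positivity), ← Real.rpow_mul (by norm_num)] at h1
    have h2 : (1 - q) * (1 / q) = 1 / q - 1 := by field_simp
    have h3 : q ^ (-2 / q) = (q ^ (1 / q))⁻¹ * (q ^ (1 / q))⁻¹ := by
      rw [← Real.rpow_neg hq.le, ← Real.rpow_add hq]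
      congr 1
      ring
    rw [h2] at h1
    rw [h3]
    gcongr
    rwa [← one_div, le_div_iff₀ (by positivity), mul_comm]
  calc X ^ (1 / q) ≤ ((F ^ q * a ^ q + F ^ q * d ^ q) / ENNReal.ofReal q) ^ (1 / q) :=
        ENNReal.rpow_le_rpow h hq'.le
    _ = F * (a ^ q + d ^ q) ^ (1 / q) * ENNReal.ofReal ((q ^ (1 / q))⁻¹) := by
        rw [ENNReal.div_rpow_of_nonneg _ _ hq'.le, ← mul_add,
          ENNReal.mul_rpow_of_nonneg _ _ hq'.le, hpow, ENNReal.ofReal_rpow_of_pos hq,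
          ENNReal.ofReal_inv_of_pos (by positivity), div_eq_mul_inv]
    _ ≤ F * (ENNReal.ofReal (2 ^ (1 / q - 1)) * (a + d)) * ENNReal.ofReal ((q ^ (1 / q))⁻¹) := by
        gcongr
        have h1 := ENNReal.rpow_add_le_mul_rpow_add_rpow (a ^ q) (d ^ q)
          (p := 1 / q) ((one_le_div hq).2 hq1.le)
        rw [hpow, hpow] at h1
        rwa [← ENNReal.ofReal_rpow_of_pos (by norm_num), ENNReal.ofReal_ofNat]
    _ = ENNReal.ofReal (2 ^ (1 / q - 1) * (q ^ (1 / q))⁻¹) * (a + d) * F := by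
        rw [ENNReal.ofReal_mul (by positivity)]
        ring
    _ ≤ _ := by gcongr

lemma laplace_le {lam q c₁ : ℝ} {c₂ : ℝ≥0∞} (hlam : 0 < lam) (hq : 0 < q) (hq1 : q < 1)
    (hc₁ : 0 ≤ c₁) {v : ℝ → ℝ} (hv : Measurable v) {B : ℝ≥0∞}
    (hB : B = (∫⁻ t in Ival c₁ c₂,
      ((ENNReal.ofReal t) ^ (-lam) - c₂ ^ (-lam)) ^ (q/(1 - q))
        * (ENNReal.ofReal t) ^ (-lam - 1) * (vbar c₁ v t) ^ (q/(1 - q))) ^ ((1 - q)/q))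
    (hBtop : B ≠ ∞) (hDtop : c₂ ^ (-(lam / q)) * vbarAll c₁ c₂ v ≠ ∞)
    {f : ℝ → ℝ} (hf : Measurable f)
    (hfint : ∫⁻ y in Ival c₁ c₂, ENNReal.ofReal (f y) ≠ ∞) :
    (∫⁻ x in Ioi (0:ℝ), (∫⁻ y in Ival c₁ c₂,
        ENNReal.ofReal (Real.exp (-(x * y ^ lam))) * ENNReal.ofReal (f y)
          * ENNReal.ofReal (v y)) ^ q) ^ (1/q)
      ≤ ENNReal.ofReal (q ^ (-2 / q))
        * (ENNReal.ofReal (lam ^ ((1 - q)/q) * (1 - q) ^ (-((1 - q)/q))) * B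
          + c₂ ^ (-(lam / q)) * vbarAll c₁ c₂ v)
        * ∫⁻ y in Ival c₁ c₂, ENNReal.ofReal (f y) := by
  have hq1' : 0 < 1 - q := by linarith
  have hr : 0 < q / (1 - q) := div_pos hq hq1'
  have hrinv : (q / (1 - q))⁻¹ = (1 - q) / q := inv_div _ _
  set F := ∫⁻ y in Ival c₁ c₂, ENNReal.ofReal (f y) with hF
  set g : ℝ → ℝ≥0∞ := fun y => ENNReal.ofReal (f y) * ENNReal.ofReal (v y) with hg
  have hgm : Measurable g := by fun_prop
  set μ := (volume.restrict (Ival c₁ c₂)).withDensity g with hμ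
  have hμS : ∀ᵐ y ∂μ, y ∈ Ival c₁ c₂ := ae_mem_Ival_withDensity c₁ c₂ g
  set ρ := powMeasure lam c₁ c₂ with hρ
  have hρS : ∀ᵐ y ∂ρ, y ∈ Ival c₁ c₂ := ae_mem_Ival_withDensity c₁ c₂ _
  set V := vbar c₁ v with hV
  have hVmono : Monotone V := monotone_vbar c₁ v
  have hWV : Measurable fun t => (powMeasure lam c₁ c₂ (Ici t) * V t) ^ (q / (1 - q)) :=
    ((measurable_measure_Ici _).mul hVmono.measurable).pow_const _
  -- the integral defining `B`, expressed through the power measure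
  have hBint : ∫⁻ t, (ρ (Ici t) * V t) ^ (q / (1 - q)) ∂ρ
      = ENNReal.ofReal lam * B ^ (q / (1 - q)) := by
    rw [hρ, lintegral_powMeasure _ _ _ hWV, hB,
      ← hrinv, ENNReal.rpow_inv_rpow hr.ne']
    congr 1
    refine setLIntegral_congr_fun (measurableSet_Ival c₁ c₂) fun t ht => ?_
    rw [powMeasure_Ici hlam hc₁ ht, ENNReal.mul_rpow_of_nonneg _ _ hr.le]
    ring
  have hBfin : ∫⁻ t, (ρ (Ici t) * V t) ^ (q / (1 - q)) ∂ρ ≠ ∞ := by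
    rw [hBint]
    exact ENNReal.mul_ne_top ENNReal.ofReal_ne_top (ENNReal.rpow_ne_top_of_nonneg hr.le hBtop)
  have hμIic : ∀ s ∈ Ival c₁ c₂, μ (Iic s) ≤ V s * F := by
    intro s hs
    have hset : Iio s ∩ Ival c₁ c₂ = Ioo c₁ s := by
      ext t
      exact ⟨fun ht => ⟨ht.2.1, ht.1⟩,
        fun ht => ⟨ht.2, ht.1, (ENNReal.ofReal_le_ofReal ht.2.le).trans_lt hs.2⟩⟩
    rw [← measure_congr Iio_ae_eq_Iic, hμ, withDensity_apply _ measurableSet_Iio,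
      Measure.restrict_restrict measurableSet_Iio, hset]
    exact setLIntegral_mul_le_essSup_mul (hset ▸ inter_subset_right) _ _ (by fun_prop)
  have hμuniv : μ univ ≤ vbarAll c₁ c₂ v * F := by
    rw [hμ, withDensity_apply _ MeasurableSet.univ, Measure.restrict_univ]
    exact setLIntegral_mul_le_essSup_mul subset_rfl _ _ (by fun_prop)
  have hμfin : ∀ y, μ (Iic y) ≠ ∞ := by
    intro y
    rcases eq_or_ne c₂ ∞ with rfl | hc₂
    · have hs : max y (c₁ + 1) ∈ Ival c₁ ∞ :=
        ⟨lt_max_of_lt_right (by linarith), ENNReal.ofReal_lt_top⟩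
      refine ne_top_of_le_ne_top ?_
        ((measure_mono (Iic_subset_Iic.2 (le_max_left y (c₁ + 1)))).trans (hμIic _ hs))
      exact ENNReal.mul_ne_top (vbar_ne_top hlam hc₁ hr v hBfin hs) hfint
    · refine ne_top_of_le_ne_top ?_ ((measure_mono (subset_univ _)).trans hμuniv)
      refine ENNReal.mul_ne_top (fun htop => hDtop ?_) hfint
      rw [htop, ENNReal.mul_top]
      rw [ENNReal.rpow_neg]
      exact ENNReal.inv_ne_zero.2 (ENNReal.rpow_ne_top_of_nonneg (div_pos hlam hq).le hc₂)
  have hVinv : ∫⁻ y, (V y)⁻¹ ∂μ ≤ F := by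
    have hVm : Measurable fun y => (V y)⁻¹ := hVmono.measurable.inv
    rw [hμ, lintegral_withDensity_eq_lintegral_mul _ hgm hVm, hF]
    refine lintegral_mono_ae ?_
    filter_upwards [ae_restrict_of_ae (ae_le_vbar c₁ v),
      ae_restrict_mem (measurableSet_Ival c₁ c₂)] with y hy hyS
    simp only [Pi.mul_apply, hg, mul_assoc]
    calc ENNReal.ofReal (f y) * (ENNReal.ofReal (v y) * (V y)⁻¹)
        ≤ ENNReal.ofReal (f y) * 1 := by
          gcongr
          exact ENNReal.div_le_of_le_mul (by simpa using hy hyS.1)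
      _ = _ := mul_one _
  have hinner : ∀ x : ℝ, ∫⁻ y in Ival c₁ c₂,
      ENNReal.ofReal (Real.exp (-(x * y ^ lam))) * ENNReal.ofReal (f y) * ENNReal.ofReal (v y)
        = ∫⁻ y, ENNReal.ofReal (Real.exp (-(x * y ^ lam))) ∂μ := by
    intro x
    rw [hμ, lintegral_withDensity_eq_lintegral_mul _ hgm (by fun_prop)]
    refine lintegral_congr fun y => ?_
    simp only [Pi.mul_apply, hg]
    ring
  simp only [hinner]
  refine rpow_inv_le_of_le_add hq hq1
    ((lintegral_laplace_rpow_le hlam hq hq1 hc₁ μ hμfin hμS).trans ?_)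
  gcongr ?_ / _
  refine add_le_add ?_ ?_
  · refine (hardy_inequality μ ρ hμS hρS (fun t => powMeasure_Ici_ne_zero hlam hc₁)
      (fun t => powMeasure_Ici_ne_top hlam hc₁) hVmono (fun s hs hs0 => ?_) hq hq1 hBfin).trans ?_
    · simpa [hs0] using hμIic s hs
    gcongr ?_ * ?_
    · exact ENNReal.rpow_le_rpow hVinv hq.le
    · rw [hBint, ← mul_assoc, ← ENNReal.ofReal_mul (by positivity),
        ENNReal.mul_rpow_of_nonneg _ _ hq1'.le, ENNReal.mul_rpow_of_nonneg _ _ hq.le,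
        ← ENNReal.rpow_mul, div_mul_cancel₀ _ hq1'.ne',
        ENNReal.ofReal_rpow_of_pos (by positivity), ENNReal.ofReal_rpow_of_pos (by positivity),
        Real.mul_rpow (by positivity) (by positivity),
        Real.mul_rpow (by positivity) (by positivity), ← Real.rpow_mul hlam.le,
        ← Real.rpow_mul hq1'.le, neg_mul, div_mul_cancel₀ _ hq.ne', Real.rpow_neg hq1'.le,
        Real.inv_rpow hq1'.le, mul_comm ((1 - q) ^ (1 - q))⁻¹]
  · calc c₂ ^ (-lam) * μ univ ^ q ≤ c₂ ^ (-lam) * (vbarAll c₁ c₂ v * F) ^ q := by gcongr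
      _ = _ := by
        rw [ENNReal.mul_rpow_of_nonneg _ _ hq.le, ENNReal.mul_rpow_of_nonneg _ _ hq.le,
          ← ENNReal.rpow_mul, neg_mul, div_mul_cancel₀ _ hq.ne']
        ring

/-! ### Lower bound -/

lemma le_of_laplace_le {lam q c₁ : ℝ} {c₂ : ℝ≥0∞} (hlam : 0 < lam) (hq : 0 < q)
    (hc₁ : 0 ≤ c₁) {v : ℝ → ℝ} (hv : Measurable v) {c : ℝ≥0∞}
    (hc : ∀ f : ℝ → ℝ, Measurable f → (∀ y, 0 ≤ f y) →
      (∫⁻ x in Ioi (0:ℝ), (∫⁻ y in Ival c₁ c₂,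
        ENNReal.ofReal (Real.exp (-(x * y ^ lam))) * ENNReal.ofReal (f y)
          * ENNReal.ofReal (v y)) ^ q) ^ (1/q)
      ≤ c * ∫⁻ y in Ival c₁ c₂, ENNReal.ofReal (f y)) {b : ℝ} (hb : 0 < b) :
    ∀ᵐ y ∂volume.restrict (Iio b ∩ Ival c₁ c₂),
      ENNReal.ofReal ((q * b ^ lam)⁻¹ ^ (1 / q)) * ENNReal.ofReal (v y) ≤ c := by
  refine ae_le_of_forall_setLIntegral_le_of_sigmaFinite (g := fun _ => c) (by fun_prop)
    fun s hs _ => ?_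
  have hSm := measurableSet_Ival c₁ c₂
  have hbl : 0 < b ^ lam := Real.rpow_pos_of_pos hb _
  have hTm : MeasurableSet (s ∩ Iio b) := hs.inter measurableSet_Iio
  have hind : ∀ y, ENNReal.ofReal ((s ∩ Iio b).indicator (fun _ => (1 : ℝ)) y)
      = (s ∩ Iio b).indicator (fun _ => (1 : ℝ≥0∞)) y := by
    intro y
    by_cases hy : y ∈ s ∩ Iio b <;> simp [hy]
  have hset : (volume.restrict (Iio b ∩ Ival c₁ c₂)).restrict s
      = (volume.restrict (Ival c₁ c₂)).restrict (s ∩ Iio b) := by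
    rw [Measure.restrict_restrict hs, Measure.restrict_restrict hTm, inter_assoc]
  have h := hc ((s ∩ Iio b).indicator fun _ => 1) (measurable_const.indicator hTm)
    (fun y => indicator_nonneg (fun _ _ => zero_le_one) y)
  simp only [hind] at h
  rw [lintegral_indicator hTm, lintegral_const, ← lintegral_const] at h
  rw [hset]
  refine le_trans ?_ (h.trans_eq (by simp))
  rw [lintegral_const_mul _ (by fun_prop)]
  set m := ∫⁻ y in s ∩ Iio b, ENNReal.ofReal (v y) ∂volume.restrict (Ival c₁ c₂) with hm
  calc ENNReal.ofReal ((q * b ^ lam)⁻¹ ^ (1 / q)) * m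
      = (∫⁻ x in Ioi (0:ℝ), (ENNReal.ofReal (Real.exp (-(x * b ^ lam))) * m) ^ q) ^ (1 / q) := by
        simp only [ENNReal.mul_rpow_of_nonneg _ _ hq.le]
        rw [lintegral_mul_const _ (by fun_prop), lintegral_exp_rpow hbl hq,
          ENNReal.mul_rpow_of_nonneg _ _ (by positivity),
          ENNReal.ofReal_rpow_of_pos (by positivity), one_div, ENNReal.rpow_rpow_inv hq.ne']
    _ ≤ _ := by
        refine ENNReal.rpow_le_rpow (setLIntegral_mono' measurableSet_Ioi fun x hx => ?_)
          (by positivity)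
        refine ENNReal.rpow_le_rpow ?_ hq.le
        rw [hm, ← lintegral_const_mul _ (by fun_prop), ← lintegral_indicator hTm]
        refine lintegral_mono_ae ((ae_restrict_mem hSm).mono fun y hyS => ?_)
        by_cases hy : y ∈ s ∩ Iio b
        · simp only [indicator_of_mem hy, mul_one]
          have hx : 0 < x := hx
          have hy0 : 0 ≤ y := hc₁.trans hyS.1.le
          have hyb : y ≤ b := le_of_lt hy.2
          gcongr
        · simp [indicator_of_notMem hy]

lemma mul_essSup_le_of_laplace_le {lam q c₁ : ℝ} {c₂ : ℝ≥0∞} (hlam : 0 < lam) (hq : 0 < q)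
    (hc₁ : 0 ≤ c₁) {v : ℝ → ℝ} (hv : Measurable v) {c : ℝ≥0∞}
    (hc : ∀ f : ℝ → ℝ, Measurable f → (∀ y, 0 ≤ f y) →
      (∫⁻ x in Ioi (0:ℝ), (∫⁻ y in Ival c₁ c₂,
        ENNReal.ofReal (Real.exp (-(x * y ^ lam))) * ENNReal.ofReal (f y)
          * ENNReal.ofReal (v y)) ^ q) ^ (1/q)
      ≤ c * ∫⁻ y in Ival c₁ c₂, ENNReal.ofReal (f y)) :
    ENNReal.ofReal (q ^ (-1 / q)) *
        essSup (fun t => (ENNReal.ofReal t) ^ (-(lam/q)) * ENNReal.ofReal (v t))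
          (volume.restrict (Ival c₁ c₂)) ≤ c := by
  rw [← ENNReal.essSup_const_mul]
  refine essSup_le_of_ae_le _ ?_
  have h : ∀ᵐ (y : ℝ) ∂volume.restrict (Ival c₁ c₂), ∀ b : ℚ, 0 < (b : ℝ) → y < (b : ℝ) →
      ENNReal.ofReal ((q * (b : ℝ) ^ lam)⁻¹ ^ (1 / q)) * ENNReal.ofReal (v y) ≤ c := by
    refine ae_all_iff.2 fun b => ?_
    by_cases hb : 0 < (b : ℝ)
    · have := le_of_laplace_le hlam hq hc₁ hv hc hb
      rw [← Measure.restrict_restrict measurableSet_Iio, ae_restrict_iff' measurableSet_Iio] at this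
      exact this.mono fun y hy _ hyb => hy hyb
    · exact ae_of_all _ fun y h => absurd h hb
  filter_upwards [h, ae_restrict_mem (measurableSet_Ival c₁ c₂)] with y hy hyS
  have hy0 : 0 < y := hc₁.trans_lt hyS.1
  have heq : ENNReal.ofReal (q ^ (-1 / q)) * (ENNReal.ofReal y ^ (-(lam / q))
      * ENNReal.ofReal (v y))
      = ENNReal.ofReal ((q * y ^ lam)⁻¹ ^ (1 / q)) * ENNReal.ofReal (v y) := by
    rw [ENNReal.ofReal_rpow_of_pos hy0, ← mul_assoc, ← ENNReal.ofReal_mul (by positivity)]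
    congr 2
    rw [Real.inv_rpow (by positivity), Real.mul_rpow hq.le (by positivity), mul_inv,
      ← Real.rpow_neg hq.le, ← Real.rpow_mul hy0.le, ← Real.rpow_neg hy0.le]
    congr 2 <;> ring
  rw [heq]
  have hcont : ContinuousAt (fun s : ℝ => (q * s ^ lam)⁻¹ ^ (1 / q)) y := by
    have hne : q * y ^ lam ≠ 0 := by positivity
    exact (((Real.continuousAt_rpow_const _ _ (Or.inl hy0.ne')).const_mul q).inv₀ hne).rpow_const
      (Or.inl (inv_ne_zero hne))
  have hlim := (ENNReal.Tendsto.mul_const (ENNReal.tendsto_ofReal hcont.tendsto)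
    (Or.inr (ENNReal.ofReal_ne_top (r := v y)))).mono_left (nhdsWithin_le_nhds (s := Ioi y))
  refine le_of_tendsto hlim (eventually_nhdsWithin_of_forall fun s hs => ?_)
  obtain ⟨b, hyb, hbs⟩ := exists_rat_btwn (show y < s from hs)
  have hb0 : 0 < (b : ℝ) := hy0.trans hyb
  have hs0 : 0 < s := hb0.trans hbs
  refine le_trans ?_ (hy b hb0 hyb)
  gcongr

theorem stmt4 (lam q c₁ : ℝ) (c₂ : ℝ≥0∞)
    (hlam : 0 < lam) (hq0 : 0 < q) (hq1 : q < 1)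
    (hc₁ : 0 ≤ c₁) (hc : ENNReal.ofReal c₁ < c₂)
    (v : ℝ → ℝ) (hv : Measurable v) (hvpos : ∀ y, 0 ≤ v y)
    (α₄ β₄ : ℝ)
    (hα₄ : α₄ = q ^ (-1/q))
    (hβ₄ : β₄ = lam ^ ((1 - q)/q) * q ^ (-2/q) * (1 - q) ^ (-((1 - q)/q)))
    (B D : ℝ≥0∞)
    -- `B = (∫_{c₁}^{c₂} (t^{-λ} - c₂^{-λ})^{q/(1-q)} t^{-λ-1} v̄(t)^{q/(1-q)} dt)^{(1-q)/q}`
    (hB : B = (∫⁻ t in Ival c₁ c₂,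
      ((ENNReal.ofReal t) ^ (-lam) - c₂ ^ (-lam)) ^ (q/(1 - q))
        * (ENNReal.ofReal t) ^ (-lam - 1) * (vbar c₁ v t) ^ (q/(1 - q))) ^ ((1 - q)/q))
    -- `D = c₂^{-λ/q} v̄(c₂)`
    (hD : D = c₂ ^ (-(lam/q)) * vbarAll c₁ c₂ v) :
    ENNReal.ofReal α₄ *
        essSup (fun t => (ENNReal.ofReal t) ^ (-(lam/q)) * ENNReal.ofReal (v t))
          (volume.restrict (Ival c₁ c₂))
      ≤ CLap1 lam q c₁ c₂ v
    ∧ CLap1 lam q c₁ c₂ v ≤ ENNReal.ofReal β₄ * B + ENNReal.ofReal (q ^ (-2/q)) * D := by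
  subst hα₄ hβ₄
  refine ⟨le_sInf fun c hc => mul_essSup_le_of_laplace_le hlam hq0 hc₁ hv hc, ?_⟩
  have hq1' : 0 < 1 - q := by linarith
  rcases eq_or_ne B ∞ with hBtop | hBtop
  · rw [hBtop, ENNReal.mul_top (by simpa using by positivity), top_add]
    exact le_top
  rcases eq_or_ne D ∞ with hDtop | hDtop
  · rw [hDtop, ENNReal.mul_top (by simpa using by positivity), add_top]
    exact le_top
  refine ENNReal.le_of_forall_pos_le_add fun ε hε _ => sInf_le fun f hf _ => ?_
  rcases eq_or_ne (∫⁻ y in Ival c₁ c₂, ENNReal.ofReal (f y)) ∞ with hfint | hfint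
  · rw [hfint, ENNReal.mul_top (by simp [hε.ne'])]
    exact le_top
  refine (laplace_le hlam hq0 hq1 hc₁ hv hB hBtop (hD ▸ hDtop) hf hfint).trans ?_
  rw [← hD, mul_add, ← mul_assoc, ← ENNReal.ofReal_mul (by positivity)]
  gcongr ?_ * _
  refine le_of_eq_of_le ?_ le_self_add
  congr 3
  ring
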